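/- arXiv:2210.08776 — 4 statements merged into one kernel-verified Lean document; each statement's English description precedes it below -/
import Mathlib

section
/- Let A be a 2-torsion-free unital ring (2t = 0 implies t = 0) containing a nontrivial idempotent e₁ (e₁ ≠ 0 and e₁ ≠ 1), write e₂ = 1 − e₁, and assume A satisfies condition (♠). Then A satisfies condition (2.1): for every t ∈ A, if the commutator [t, a] = ta − at lies in the center Z(A) for all a ∈ A, then t ∈ Z(A). -/
/-- Condition (♠) for a unital ring with idempotent `e₁` (and `e₂ = 1 - e₁`). -/
def Spade {A : Type*} [Ring A] (e₁ : A) : Prop :=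
  (∀ t : A, (∀ a : A, e₁ * t * e₁ * (e₁ * a * (1 - e₁)) = 0 ∧
      ((1 - e₁) * a * e₁) * (e₁ * t * e₁) = 0) → e₁ * t * e₁ = 0) ∧
  (∀ t : A, (∀ a : A, (e₁ * a * (1 - e₁)) * ((1 - e₁) * t * (1 - e₁)) = 0 ∧
      ((1 - e₁) * t * (1 - e₁)) * ((1 - e₁) * a * e₁) = 0) →
      (1 - e₁) * t * (1 - e₁) = 0)

theorem commutator_mul_eq_zero {A : Type*} [Ring A] {t x y : A}
    (hy : Commute t y) (hxy : Commute t (x * y)) : (t * x - x * t) * y = 0 := by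
  rw [sub_mul, mul_assoc, mul_assoc x t y, hxy.eq, hy.eq, mul_assoc, sub_self]

theorem mul_commutator_eq_zero {A : Type*} [Ring A] {t x y : A}
    (hy : Commute t y) (hyx : Commute t (y * x)) : y * (t * x - x * t) = 0 := by
  rw [mul_sub, ← mul_assoc, ← mul_assoc y x t, ← hyx.eq, ← hy.eq, mul_assoc, sub_self]

theorem commutator_sandwich {A : Type*} [Ring A] {t p q : A} (hp : Commute t p)
    (hq : Commute t q) (a : A) :
    p * (t * a - a * t) * q = t * (p * a * q) - p * a * q * t := by
  rw [mul_sub, sub_mul, ← mul_assoc p t a, ← hp.eq]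
  simp only [mul_assoc, hq.eq]

theorem commute_idempotent_of_commutators_central {A : Type*} [Ring A] {t e : A}
    (he : e * e = e) (hc : ∀ a b : A, (t * a - a * t) * b = b * (t * a - a * t)) :
    Commute t e := by
  have h1 : (t * e - e * t) * e = 0 := by
    calc (t * e - e * t) * e = (t * e - e * t) * e * e := by rw [mul_assoc _ e e, he]
      _ = e * (t * e - e * t) * e := by rw [hc e e]
      _ = e * t * (e * e) - e * e * t * e := by noncomm_ring
      _ = 0 := by rw [he, sub_self]
  have h3 : t * e - e * t = 0 := by
    calc t * e - e * t = t * (e * e) - e * e * t := by rw [he]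
      _ = (t * e - e * t) * e + e * (t * e - e * t) := by noncomm_ring
      _ = 0 := by rw [← hc e e, h1, add_zero]
  exact sub_eq_zero.mp h3

theorem commute_corner_of_commutators_central {A : Type*} [Ring A] {t p q : A}
    (hpq : p * q = 0) (hp : Commute t p) (hq : Commute t q)
    (hc : ∀ a b : A, (t * a - a * t) * b = b * (t * a - a * t)) (a : A) :
    Commute t (p * a * q) := by
  have h : t * (p * a * q) - p * a * q * t = 0 := by
    rw [← commutator_sandwich hp hq, ← hc a p, mul_assoc, hpq, mul_zero]
  exact sub_eq_zero.mp h

/-- A 2-torsion-free unital ring with a nontrivial idempotent satisfying (♠)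
satisfies condition (2.1): if all commutators `[t, a]` are central, then `t` is central. -/
theorem stmt_0 {A : Type*} [Ring A]
    (h2 : ∀ t : A, 2 * t = 0 → t = 0)
    (e₁ : A) (hidem : e₁ * e₁ = e₁) (he0 : e₁ ≠ 0) (he1 : e₁ ≠ 1)
    (hsp : Spade e₁) :
    ∀ t : A, (∀ a b : A, (t * a - a * t) * b = b * (t * a - a * t)) →
      ∀ a : A, t * a = a * t := by
  intro t hc a
  obtain ⟨hs1, hs2⟩ := hsp
  have he : Commute t e₁ := commute_idempotent_of_commutators_central hidem hc
  have hf : Commute t (1 - e₁) := (Commute.one_right t).sub_right he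
  have hef : e₁ * (1 - e₁) = 0 := by rw [mul_sub, mul_one, hidem, sub_self]
  have hfe : (1 - e₁) * e₁ = 0 := by rw [sub_mul, one_mul, hidem, sub_self]
  have h12 := commute_corner_of_commutators_central hef he hf hc
  have h21 := commute_corner_of_commutators_central hfe hf he hc
  have h11 : Commute t (e₁ * a * e₁) := by
    refine sub_eq_zero.mp ?_
    rw [← commutator_sandwich he he]
    refine hs1 _ fun b => ?_
    rw [commutator_sandwich he he]
    constructor
    · refine commutator_mul_eq_zero (h12 b) ?_
      simpa only [mul_assoc] using h12 (a * e₁ * e₁ * b)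
    · refine mul_commutator_eq_zero (h21 b) ?_
      simpa only [mul_assoc] using h21 (b * e₁ * e₁ * a)
  have h22 : Commute t ((1 - e₁) * a * (1 - e₁)) := by
    refine sub_eq_zero.mp ?_
    rw [← commutator_sandwich hf hf]
    refine hs2 _ fun b => ?_
    rw [commutator_sandwich hf hf]
    constructor
    · refine mul_commutator_eq_zero (h12 b) ?_
      simpa only [mul_assoc] using h12 (b * (1 - e₁) * (1 - e₁) * a)
    · refine commutator_mul_eq_zero (h21 b) ?_
      simpa only [mul_assoc] using h21 (a * (1 - e₁) * (1 - e₁) * b)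
  have hdecomp : a = e₁ * a * e₁ + e₁ * a * (1 - e₁) + (1 - e₁) * a * e₁ +
      (1 - e₁) * a * (1 - e₁) := by noncomm_ring
  have h : Commute t a := by
    rw [hdecomp]
    exact ((h11.add_right (h12 a)).add_right (h21 a)).add_right h22
  exact h.eq
end

section
/- Let n ≥ 2 be an integer and let A be a 2-torsion-free unital ring (2t = 0 implies t = 0) containing a nontrivial idempotent e₁ (e₁ ≠ 0 and e₁ ≠ 1), write e₂ = 1 − e₁, and assume A satisfies condition (♠). Then every multiplicative Jordan n-centralizer Φ : A → A is of the form Φ(t) = μt for all t ∈ A, where μ is an element of the center Z(A) (indeed μ = Φ(1)). -/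
/-- The Jordan `n`-product `qₙ(t₁,…,tₙ)`, folding the Jordan product `a∘b = ab + ba`
from the left: `q₁(t₁) = t₁`, `qₙ(t₁,…,tₙ) = qₙ₋₁(t₁,…,tₙ₋₁)∘tₙ`. -/
def jordanProd {A : Type*} [Ring A] : List A → A
  | [] => 0
  | t :: ts => ts.foldl (fun x y => x * y + y * x) t

/-- A map `Φ` (not assumed additive) is a multiplicative Jordan `n`-centralizer if
`Φ(qₙ(t₁,t₂,…,tₙ)) = qₙ(Φ(t₁),t₂,…,tₙ)` for all `t₁,…,tₙ`. -/
def IsMulJordanCentralizer {A : Type*} [Ring A] (n : ℕ) (Φ : A → A) : Prop :=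
  ∀ l : List A, l.length = n →
    Φ (jordanProd l) = jordanProd (l.set 0 (Φ (l.getD 0 0)))

lemma foldl_jordan_replicate_one {A : Type*} [Ring A] (k : ℕ) (x : A) :
    (List.replicate k (1 : A)).foldl (fun x y => x * y + y * x) x = 2 ^ k * x := by
  induction k generalizing x with
  | zero => simp
  | succ k ih =>
    rw [List.replicate_succ, List.foldl_cons, ih, pow_succ, mul_assoc, mul_one, one_mul, two_mul]

lemma eq_zero_of_two_pow_mul_eq_zero {A : Type*} [Ring A] (h2 : ∀ t : A, 2 * t = 0 → t = 0)
    (k : ℕ) (t : A) (h : 2 ^ k * t = 0) : t = 0 := by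
  induction k with
  | zero => simpa using h
  | succ k ih => exact ih (h2 _ (by rw [← mul_assoc, ← pow_succ', h]))

/-- A multiplicative Jordan centralizer satisfies `Φ(2ᵏ(x∘y)) = 2ᵏ(Φ(x)∘y)`. -/
lemma IsMulJordanCentralizer.map_two_pow_mul {A : Type*} [Ring A] {k : ℕ} {Φ : A → A}
    (hΦ : IsMulJordanCentralizer (k + 2) Φ) (x y : A) :
    Φ (2 ^ k * (x * y + y * x)) = 2 ^ k * (Φ x * y + y * Φ x) := by
  have h := hΦ (x :: y :: List.replicate k 1) (by simp)
  simpa [jordanProd, foldl_jordan_replicate_one] using h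

/-- If every commutator with `m` is central, then `m` commutes with every idempotent. -/
lemma commute_idempotent_of_central_commutators {A : Type*} [Ring A] {m e : A}
    (he : e * e = e) (hc : ∀ x y : A, (y * m - m * y) * x = x * (y * m - m * y)) :
    e * m = m * e := by
  have h := hc e e
  have h1 : e * m * e = e * m := by
    have h3 := congrArg (e * ·) h
    simp only [mul_sub, sub_mul, ← mul_assoc, he] at h3
    simp only [mul_assoc, he] at h3 ⊢
    rw [sub_self] at h3
    exact (sub_eq_zero.mp h3.symm).symm
  have h2 : e * m * e = m * e := by
    have h3 := congrArg (· * e) h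
    simp only [mul_sub, sub_mul, mul_assoc, he] at h3
    simp only [mul_assoc]
    simp only [← mul_assoc, he] at h3 ⊢
    rw [sub_self] at h3
    exact sub_eq_zero.mp h3
  exact h1.symm.trans h2

/-- Under `Spade e`, an element `m` whose commutators are all central is itself central. -/
lemma central_of_central_commutators {A : Type*} [Ring A] {m e : A} (he : e * e = e)
    (hsp : Spade e) (hc : ∀ x y : A, (y * m - m * y) * x = x * (y * m - m * y)) (t : A) :
    t * m = m * t := by
  have hem := commute_idempotent_of_central_commutators he hc
  set d := t * m - m * t with hd
  have hdc : ∀ x, d * x = x * d := fun x => hc x t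
  have he' : e * (1 - e) = 0 := by rw [mul_sub, he, mul_one, sub_self]
  have he'' : (1 - e) * e = 0 := by rw [sub_mul, he, one_mul, sub_self]
  have hf : (1 - e) * (1 - e) = 1 - e := by rw [sub_mul, he', one_mul, sub_zero]
  have hfm : (1 - e) * m = m * (1 - e) := by rw [sub_mul, mul_sub, hem, one_mul, mul_one]
  -- corner compressions of `d` are themselves commutators with `m`, hence central
  have corner : ∀ p : A, p * m = m * p → ∀ x, p * d * p * x = x * (p * d * p) := by
    intro p hpm x
    have : p * d * p = (p * t * p) * m - m * (p * t * p) := by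
      rw [hd, mul_sub, sub_mul]
      congr 1
      · simp only [mul_assoc, hpm]
      · simp only [← mul_assoc, hpm]
    rw [this]
    exact hc _ _
  have h1 : e * d * e = 0 := by
    refine hsp.1 d fun a => ⟨?_, ?_⟩
    · rw [corner e hem]
      simp only [mul_assoc, ← mul_assoc (1 - e) e, he'', zero_mul, mul_zero]
    · rw [← corner e hem]
      simp only [mul_assoc, ← mul_assoc e (1 - e), he', zero_mul, mul_zero]
  have h2 : (1 - e) * d * (1 - e) = 0 := by
    refine hsp.2 d fun a => ⟨?_, ?_⟩
    · rw [← corner (1 - e) hfm]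
      simp only [mul_assoc, ← mul_assoc (1 - e) e, he'', zero_mul, mul_zero]
    · rw [corner (1 - e) hfm]
      simp only [mul_assoc, ← mul_assoc e (1 - e), he', zero_mul, mul_zero]
  rw [mul_assoc, hdc, ← mul_assoc, he, ← hdc] at h1
  rw [mul_assoc, hdc, ← mul_assoc, hf, ← hdc, mul_sub, mul_one, h1, sub_zero] at h2
  exact sub_eq_zero.mp h2

/-- Every multiplicative Jordan `n`-centralizer on a 2-torsion-free unital ring with a
nontrivial idempotent satisfying (♠) has the form `Φ(t) = μt` with `μ = Φ(1)` central. -/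
theorem stmt_1 {A : Type*} [Ring A] (n : ℕ) (hn : 2 ≤ n)
    (h2 : ∀ t : A, 2 * t = 0 → t = 0)
    (e₁ : A) (hidem : e₁ * e₁ = e₁) (he0 : e₁ ≠ 0) (he1 : e₁ ≠ 1)
    (hsp : Spade e₁)
    (Φ : A → A) (hΦ : IsMulJordanCentralizer n Φ) :
    (∀ a : A, Φ 1 * a = a * Φ 1) ∧ ∀ t : A, Φ t = Φ 1 * t := by
  obtain ⟨k, rfl⟩ := Nat.exists_eq_add_of_le' hn
  have cancel : ∀ x y : A, 2 * x = 2 * y → x = y := fun x y h =>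
    sub_eq_zero.mp (h2 _ (by rw [mul_sub, h, sub_self]))
  have cancel_pow : ∀ x y : A, 2 ^ k * x = 2 ^ k * y → x = y := fun x y h =>
    sub_eq_zero.mp (eq_zero_of_two_pow_mul_eq_zero h2 k _ (by rw [mul_sub, h, sub_self]))
  have hmap := hΦ.map_two_pow_mul
  have hsymm : ∀ x y : A, Φ x * y + y * Φ x = Φ y * x + x * Φ y := fun x y =>
    cancel_pow _ _ (by rw [← hmap, ← hmap, add_comm (x * y)])
  have hdouble : ∀ x : A, 2 * Φ x = Φ 1 * x + x * Φ 1 := fun x => by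
    rw [← hsymm x 1, mul_one, one_mul, two_mul]
  have hjordan : ∀ x y : A, Φ 1 * (x * y + y * x) + (x * y + y * x) * Φ 1 =
      (Φ 1 * x + x * Φ 1) * y + y * (Φ 1 * x + x * Φ 1) := fun x y => by
    apply cancel_pow
    have hcomm : ∀ a : A, a * 2 ^ k = 2 ^ k * a := fun a =>
      ((Commute.ofNat_right a 2).pow_right k).eq
    have h := hdouble (2 ^ k * (x * y + y * x))
    rw [hmap, ← mul_assoc (Φ 1), hcomm, mul_assoc, mul_assoc, ← mul_add] at h
    rw [← h, ← hdouble, ← mul_assoc 2, hcomm 2, mul_assoc]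
    congr 1
    noncomm_ring
  have hcentral : ∀ t : A, t * Φ 1 = Φ 1 * t := by
    refine central_of_central_commutators hidem hsp fun x y => ?_
    have h := hjordan x y
    rw [← sub_eq_zero] at h ⊢
    rw [← neg_eq_zero, ← h]
    noncomm_ring
  refine ⟨fun a => (hcentral a).symm, fun t => cancel _ _ ?_⟩
  rw [hdouble, hcentral, two_mul]
end

section
/- Let n ≥ 2 be an integer and let A be a 2-torsion-free unital ring (2t = 0 implies t = 0) containing a nontrivial idempotent e₁ (e₁ ≠ 0 and e₁ ≠ 1), write e₂ = 1 − e₁, and assume A satisfies condition (♠). Then every multiplicative generalized Jordan n-derivation Δ : A → A is additive; more precisely, there exist μ in the center Z(A) and an additive Jordan n-derivation δ : A → A such that Δ(t) = μt + δ(t) for all t ∈ A. -/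
/-- A map `δ` (not assumed additive) is a multiplicative Jordan `n`-derivation if
`δ(qₙ(t₁,…,tₙ)) = Σᵢ qₙ(t₁,…,δ(tᵢ),…,tₙ)` for all `t₁,…,tₙ`. -/
def IsMulJordanDeriv {A : Type*} [Ring A] (n : ℕ) (δ : A → A) : Prop :=
  ∀ l : List A, l.length = n →
    δ (jordanProd l) = ∑ i ∈ Finset.range n, jordanProd (l.set i (δ (l.getD i 0)))

/-- A map `Δ` is a multiplicative generalized Jordan `n`-derivation (with associated
multiplicative Jordan `n`-derivation `δ`) if
`Δ(qₙ(t₁,…,tₙ)) = qₙ(Δ(t₁),t₂,…,tₙ) + Σᵢ₌₂ⁿ qₙ(t₁,…,δ(tᵢ),…,tₙ)`. -/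
def IsMulGenJordanDeriv {A : Type*} [Ring A] (n : ℕ) (Δ δ : A → A) : Prop :=
  ∀ l : List A, l.length = n →
    Δ (jordanProd l) = jordanProd (l.set 0 (Δ (l.getD 0 0)))
      + ∑ i ∈ Finset.Ico 1 n, jordanProd (l.set i (δ (l.getD i 0)))

section Peirce

variable {A : Type*} [Ring A] {e f : A}

/-- A map `T` in two variables, vanishing when one of them does and commuting with all Jordan
multiplications, respects the Peirce corners of `e` and `f`, is zero on the pairs of off-diagonal
elements and takes diagonal values. -/
lemma peirce_of_jordanMul (h2 : ∀ t : A, 2 * t = 0 → t = 0)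
    (hee : e * e = e) (hff : f * f = f) (hef : e * f = 0) (hfe : f * e = 0) (h1 : e + f = 1)
    {T : A → A → A} (hl : ∀ x, T 0 x = 0) (hr : ∀ x, T x 0 = 0)
    (hT : ∀ b x y, T (x * b + b * x) (y * b + b * y) = T x y * b + b * T x y) :
    (∀ x y, T (e * x * e) (e * y * e) = e * T x y * e) ∧
    (∀ x y, T (f * x * f) (f * y * f) = f * T x y * f) ∧
    (∀ x y, T (e * x * f + f * x * e) (e * y * f + f * y * e) = 0) ∧
    (∀ x y, T x y = e * T x y * e + f * T x y * f) := by
  have hee' : ∀ x, e * (e * x) = e * x := fun x => by rw [← mul_assoc, hee]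
  have hff' : ∀ x, f * (f * x) = f * x := fun x => by rw [← mul_assoc, hff]
  have hef' : ∀ x, e * (f * x) = 0 := fun x => by rw [← mul_assoc, hef, zero_mul]
  have hfe' : ∀ x, f * (e * x) = 0 := fun x => by rw [← mul_assoc, hfe, zero_mul]
  have hsplit : ∀ x, x = e * x * e + f * x * f + (e * x * f + f * x * e) := fun x => by
    calc x = (e + f) * x * (e + f) := by rw [h1, one_mul, mul_one]
      _ = _ := by noncomm_ring
  have hdouble : ∀ x y, T (2 * x) (2 * y) = 2 * T x y := fun x y => by
    simpa [two_mul] using hT 1 x y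
  have hquad : ∀ x y, T (2 * (2 * x)) (2 * (2 * y)) = 2 * (2 * T x y) := fun x y => by
    rw [hdouble, hdouble]
  have hcancel : ∀ x y : A, 2 * (2 * x) = 2 * (2 * y) → x = y := fun x y h =>
    sub_eq_zero.1 (h2 _ (h2 _ (by rw [mul_sub, mul_sub, h, sub_self])))
  have hcorner : ∀ g : A, g * g = g → ∀ x,
      (x * (2 * g - 1) + (2 * g - 1) * x) * g + g * (x * (2 * g - 1) + (2 * g - 1) * x)
        = 2 * (2 * (g * x * g)) := by
    intro g hg x
    have k : ∀ x, g * (g * x) = g * x := fun x => by rw [← mul_assoc, hg]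
    simp only [mul_sub, sub_mul, mul_add, add_mul, mul_assoc, hg, k, two_mul, mul_one, one_mul]
    abel
  have hdiag : ∀ g : A, g * g = g → ∀ x y, T (g * x * g) (g * y * g) = g * T x y * g := by
    intro g hg x y
    apply hcancel
    rw [← hquad, ← hcorner g hg, ← hcorner g hg, ← hcorner g hg, hT, hT]
  have hoff' : ∀ x, (x * e + e * x) * f + f * (x * e + e * x) = e * x * f + f * x * e := fun x => by
    simp [mul_add, add_mul, mul_assoc, hef, hfe']
  have hoff : ∀ x y, T (e * x * f + f * x * e) (e * y * f + f * y * e)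
      = e * T x y * f + f * T x y * e := fun x y => by
    rw [← hoff', ← hoff', ← hoff', hT, hT]
  have hsum : ∀ x y, T x y = T (e * x * e) (e * y * e) + T (f * x * f) (f * y * f)
      + T (e * x * f + f * x * e) (e * y * f + f * y * e) := fun x y => by
    rw [hdiag e hee, hdiag f hff, hoff]
    exact hsplit _
  have hzero : ∀ x y, T (e * x * f + f * x * e) (e * y * f + f * y * e) = 0 := fun x y => by
    set u := e * x * f + f * x * e with hu
    set v := e * y * f + f * y * e with hv
    have h0 : T e v = 0 := by
      rw [hsum]
      simp [hv, mul_add, mul_assoc, hee, hff, hef, hfe, hef', hfe', hl, hr]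
    have hu11 : e * u * e = 0 := by simp [hu, mul_add, mul_assoc, hfe, hef']
    have hu22 : f * u * f = 0 := by simp [hu, mul_add, mul_assoc, hef, hfe']
    have hw12 : e * (v * u + u * v) * f = 0 := by
      simp [hu, hv, mul_add, add_mul, mul_assoc, hef, hfe', hef', hee', hff']
    have hw21 : f * (v * u + u * v) * e = 0 := by
      simp [hu, hv, mul_add, add_mul, mul_assoc, hfe, hfe', hef', hee', hff']
    have heu : e * (f + u) + (f + u) * e = u := by
      simp [hu, mul_add, add_mul, mul_assoc, hee, hfe, hef, hef', hee']
    have hvu : v * (f + u) + (f + u) * v = v + (v * u + u * v) := by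
      have : v * f + f * v = v := by
        simp [hv, mul_add, add_mul, mul_assoc, hff, hef, hfe', hff']
      calc _ = (v * f + f * v) + (v * u + u * v) := by noncomm_ring
        _ = _ := by rw [this]
    have h3 := hT (f + u) e v
    rw [h0, zero_mul, mul_zero, add_zero, heu, hvu, hsum, hu11, hu22, hl, hl,
      mul_add e v (_ + _), mul_add f v (_ + _), add_mul _ _ f, add_mul _ _ e, hw12, hw21,
      add_zero, add_zero] at h3
    rw [hsum, hu11, hu22, hl, hl, zero_add]
    simpa only [zero_add, add_zero] using h3
  refine ⟨hdiag e hee, hdiag f hff, hzero, fun x y => ?_⟩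
  rw [← hdiag e hee, ← hdiag f hff]
  simpa [hzero] using hsum x y

/-- A map `T` in two variables, vanishing when one of them does and commuting with all Jordan
multiplications, vanishes under condition (♠). -/
lemma eq_zero_of_jordanMul (h2 : ∀ t : A, 2 * t = 0 → t = 0)
    (hee : e * e = e) (hsp : Spade e)
    {T : A → A → A} (hl : ∀ x, T 0 x = 0) (hr : ∀ x, T x 0 = 0)
    (hT : ∀ b x y, T (x * b + b * x) (y * b + b * y) = T x y * b + b * T x y) (x y : A) :
    T x y = 0 := by
  obtain ⟨f, hf⟩ : ∃ f, f = 1 - e := ⟨_, rfl⟩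
  unfold Spade at hsp
  rw [← hf] at hsp
  have hff : f * f = f := by simp [hf, mul_sub, sub_mul, hee]
  have hef : e * f = 0 := by simp [hf, mul_sub, hee]
  have hfe : f * e = 0 := by simp [hf, sub_mul, hee]
  have h1 : e + f = 1 := by simp [hf]
  have hee' : ∀ x, e * (e * x) = e * x := fun x => by rw [← mul_assoc, hee]
  have hff' : ∀ x, f * (f * x) = f * x := fun x => by rw [← mul_assoc, hff]
  have hef' : ∀ x, e * (f * x) = 0 := fun x => by rw [← mul_assoc, hef, zero_mul]
  have hfe' : ∀ x, f * (e * x) = 0 := fun x => by rw [← mul_assoc, hfe, zero_mul]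
  obtain ⟨h11, h22, hoff, hsum⟩ := peirce_of_jordanMul h2 hee hff hef hfe h1 hl hr hT
  have key1 : ∀ a, e * T x y * e * (e * a * f) + f * a * e * (e * T x y * e) = 0 := fun a => by
    have h := hT (e * a * f + f * a * e) (e * x * e) (e * y * e)
    have hz : ∀ x, e * x * e * (e * a * f + f * a * e) + (e * a * f + f * a * e) * (e * x * e)
        = e * (e * x * e * a * f + f * a * e * x * e) * f
          + f * (e * x * e * a * f + f * a * e * x * e) * e := fun x => by
      simp [mul_add, add_mul, mul_assoc, hee, hff, hef', hfe', hee', hff']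
    rw [hz, hz, hoff, h11] at h
    simpa [mul_add, add_mul, mul_assoc, hef', hfe', hee', hff'] using h.symm
  have key2 : ∀ a, e * a * f * (f * T x y * f) + f * T x y * f * (f * a * e) = 0 := fun a => by
    have h := hT (e * a * f + f * a * e) (f * x * f) (f * y * f)
    have hz : ∀ x, f * x * f * (e * a * f + f * a * e) + (e * a * f + f * a * e) * (f * x * f)
        = e * (e * a * f * x * f + f * x * f * a * e) * f
          + f * (e * a * f * x * f + f * x * f * a * e) * e := fun x => by
      simp [mul_add, add_mul, mul_assoc, hee, hff, hef', hfe', hee', hff', add_comm]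
    rw [hz, hz, hoff, h22] at h
    simpa [mul_add, add_mul, mul_assoc, hef', hfe', hee', hff', add_comm] using h.symm
  have hT1 : e * T x y * e = 0 := hsp.1 _ fun a =>
    ⟨by simpa [mul_add, mul_assoc, hef', hee'] using congrArg (e * ·) (key1 a),
      by simpa [mul_add, mul_assoc, hfe', hff'] using congrArg (f * ·) (key1 a)⟩
  have hT2 : f * T x y * f = 0 := hsp.2 _ fun a =>
    ⟨by simpa [mul_add, mul_assoc, hef', hee'] using congrArg (e * ·) (key2 a),
      by simpa [mul_add, mul_assoc, hfe', hff'] using congrArg (f * ·) (key2 a)⟩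
  rw [hsum, hT1, hT2, add_zero]

/-- An element whose commutators are all central is itself central under condition (♠). -/
lemma commute_of_commutator_central (hee : e * e = e) (hsp : Spade e) {d : A}
    (hd : ∀ b x, (d * b - b * d) * x = x * (d * b - b * d)) (a : A) : d * a = a * d := by
  obtain ⟨f, hf⟩ : ∃ f, f = 1 - e := ⟨_, rfl⟩
  unfold Spade at hsp
  rw [← hf] at hsp
  have hff : f * f = f := by simp [hf, mul_sub, sub_mul, hee]
  have hef : e * f = 0 := by simp [hf, mul_sub, hee]
  have hfe : f * e = 0 := by simp [hf, sub_mul, hee]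
  have h1 : e + f = 1 := by simp [hf]
  have hee' : ∀ x, e * (e * x) = e * x := fun x => by rw [← mul_assoc, hee]
  have hff' : ∀ x, f * (f * x) = f * x := fun x => by rw [← mul_assoc, hff]
  have hef' : ∀ x, e * (f * x) = 0 := fun x => by rw [← mul_assoc, hef, zero_mul]
  have hfe' : ∀ x, f * (e * x) = 0 := fun x => by rw [← mul_assoc, hfe, zero_mul]
  have hedf : e * (d * f) = 0 := by
    have h := congrArg (fun z => e * z * f) (hd e e)
    simpa [mul_sub, sub_mul, mul_assoc, hee, hef, hee'] using h
  have hfde : f * (d * e) = 0 := by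
    have h := congrArg (fun z => f * z * e) (hd e e)
    simpa [mul_sub, sub_mul, mul_assoc, hee, hfe, hfe'] using h
  have hde : d * e = e * d := by
    calc d * e = (e + f) * (d * e) := by rw [h1, one_mul]
      _ = e * (d * (e + f)) := by rw [add_mul, mul_add, mul_add, hfde, hedf]
      _ = e * d := by rw [h1, mul_one]
  have hdf : d * f = f * d := by rw [hf, mul_sub, sub_mul, hde, mul_one, one_mul]
  have hde' : ∀ x, d * (e * x) = e * (d * x) := fun x => by
    rw [← mul_assoc, hde, mul_assoc]
  have hdf' : ∀ x, d * (f * x) = f * (d * x) := fun x => by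
    rw [← mul_assoc, hdf, mul_assoc]
  have h12 : d * (e * a * f) - e * a * f * d = 0 := by
    have h := hd (e * a * f) e
    simpa [mul_sub, sub_mul, mul_assoc, hee', hfe, hde, hdf, hde', hdf', hef', hfe', eq_comm]
      using h
  have h21 : d * (f * a * e) - f * a * e * d = 0 := by
    have h := hd (f * a * e) e
    simpa [mul_sub, sub_mul, mul_assoc, hee, hee', hff', hde, hde', hdf', hef', hfe'] using h
  have hc1 : ∀ x, d * (e * x * e) - e * x * e * d = e * (d * x - x * d) * e := fun x => by
    simp [mul_sub, sub_mul, mul_assoc, hde, hde']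
  have hc2 : ∀ x, d * (f * x * f) - f * x * f * d = f * (d * x - x * d) * f := fun x => by
    simp [mul_sub, sub_mul, mul_assoc, hdf, hdf']
  have h11 : d * (e * a * e) - e * a * e * d = 0 := by
    rw [hc1]
    refine hsp.1 _ fun b => ?_
    rw [← hc1, hd, ← hd _ (f * b * e), hc1]
    simp [mul_assoc, hef', hfe']
  have h22 : d * (f * a * f) - f * a * f * d = 0 := by
    rw [hc2]
    refine hsp.2 _ fun b => ?_
    rw [← hc2, hd _ (f * b * e), ← hd _ (e * b * f), hc2]
    simp [mul_assoc, hef', hfe']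
  have ha : a = e * a * e + e * a * f + (f * a * e + f * a * f) := by
    rw [← mul_add, ← mul_add, h1, mul_one, mul_one, ← add_mul, h1, one_mul]
  rw [← sub_eq_zero, ha]
  calc _ = (d * (e * a * e) - e * a * e * d) + (d * (e * a * f) - e * a * f * d)
        + ((d * (f * a * e) - f * a * e * d) + (d * (f * a * f) - f * a * f * d)) := by
          noncomm_ring
    _ = 0 := by rw [h11, h12, h21, h22]; simp

end Peirce

section Fold

variable {A : Type*} [Ring A]

/-- Iterated Jordan multiplication by the elements of a list, as an additive map. -/
def jordanFold (ts : List A) : A →+ A where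
  toFun t := ts.foldl (fun x y => x * y + y * x) t
  map_zero' := by induction ts <;> simp_all
  map_add' x y := by
    induction ts generalizing x y with
    | nil => rfl
    | cons t ts ih =>
      simp only [List.foldl_cons]
      rw [← ih]
      congr 1
      noncomm_ring

lemma jordanProd_cons (t : A) (ts : List A) : jordanProd (t :: ts) = jordanFold ts t := rfl

lemma jordanFold_replicate_one (m : ℕ) (t : A) :
    jordanFold (List.replicate m 1) t = 2 ^ m * t := by
  induction m generalizing t with
  | zero => simp [jordanFold]
  | succ m ih =>
    have : jordanFold (List.replicate (m + 1) 1) t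
        = jordanFold (List.replicate m 1) (t * 1 + 1 * t) := rfl
    rw [this, ih, pow_succ, mul_assoc, mul_one, one_mul, two_mul]

lemma jordanFold_cons_replicate_one (m : ℕ) (b t : A) :
    jordanFold (b :: List.replicate m 1) t = 2 ^ m * (t * b + b * t) :=
  jordanFold_replicate_one m _

lemma IsMulJordanDeriv.isMulGenJordanDeriv {n : ℕ} (hn : 0 < n) {δ : A → A}
    (h : IsMulJordanDeriv n δ) : IsMulGenJordanDeriv n δ δ := fun l hl => by
  rw [h l hl, Finset.range_eq_Ico, Finset.sum_eq_sum_Ico_succ_bot hn]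

lemma jordanProd_eq_zero {l : List A} (h : 0 ∈ l) : jordanProd l = 0 := by
  obtain ⟨s, t, rfl⟩ := List.append_of_mem h
  cases s with
  | nil => rw [List.nil_append, jordanProd_cons, _root_.map_zero]
  | cons a s =>
    have : jordanProd (a :: s ++ 0 :: t)
        = jordanFold t (jordanFold s a * 0 + 0 * jordanFold s a) := by
      simp [jordanProd, jordanFold]
    rw [this, mul_zero, zero_mul, add_zero, _root_.map_zero]

lemma IsMulJordanDeriv.map_zero {n : ℕ} (hn : 2 ≤ n) {δ : A → A} (h : IsMulJordanDeriv n δ) :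
    δ 0 = 0 := by
  have h0 := h (List.replicate n 0) List.length_replicate
  rw [jordanProd_eq_zero (List.mem_replicate.2 ⟨by lia, rfl⟩)] at h0
  rw [h0]
  refine Finset.sum_eq_zero fun i _ => jordanProd_eq_zero ?_
  rw [List.mem_iff_getElem]
  rcases Nat.eq_zero_or_pos i with rfl | hi
  · exact ⟨1, by simp; lia, by simp⟩
  · exact ⟨0, by simp; lia, by simp [hi.ne']⟩

/-- The multiplicative generalized Jordan `n`-derivations with a given associated derivation
satisfy one common affine rule with respect to the first argument. -/
lemma exists_addMonoidHom_jordanFold (δ : A → A) (ts : List A) :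
    ∃ R : A →+ A, ∀ Δ : A → A, IsMulGenJordanDeriv (ts.length + 1) Δ δ →
      ∀ x, Δ (jordanFold ts x) = jordanFold ts (Δ x) + R x := by
  refine ⟨∑ i ∈ Finset.range ts.length, jordanFold (ts.set i (δ (ts.getD i 0))), fun Δ hΔ x => ?_⟩
  have h := hΔ (x :: ts) rfl
  rw [Finset.sum_Ico_eq_sum_range] at h
  simpa [jordanProd_cons, add_comm 1] using h

lemma eq_of_two_pow_mul_eq (h2 : ∀ t : A, 2 * t = 0 → t = 0) (m : ℕ) {x y : A}
    (h : 2 ^ m * x = 2 ^ m * y) : x = y := by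
  induction m with
  | zero => simpa using h
  | succ m ih =>
    refine ih (sub_eq_zero.1 (h2 _ ?_))
    rw [mul_sub, ← mul_assoc, ← mul_assoc, ← pow_succ', h, sub_self]

/-- A map commuting with the Jordan multiplications scaled by `2 ^ m` commutes with the Jordan
multiplications. -/
lemma map_jordanMul_of_two_pow (h2 : ∀ t : A, 2 * t = 0 → t = 0) (m : ℕ) {X : Type*} [Ring X]
    (φ : A →+* X) (F : X → A)
    (hF : ∀ b x, F (2 ^ m * (x * φ b + φ b * x)) = 2 ^ m * (F x * b + b * F x)) (b : A) (x : X) :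
    F (x * φ b + φ b * x) = F x * b + b * F x := by
  apply eq_of_two_pow_mul_eq h2 (m + 1)
  have h := hF 1 (x * φ b + φ b * x)
  have h' := hF (2 * b) x
  have e1 : (x * φ b + φ b * x) * φ 1 + φ 1 * (x * φ b + φ b * x)
      = x * φ (2 * b) + φ (2 * b) * x := by
    rw [map_one, map_mul, map_ofNat]
    noncomm_ring
  rw [e1, h'] at h
  rw [pow_succ, mul_assoc, mul_assoc]
  convert h.symm using 2 <;> noncomm_ring

end Fold

/-- A multiplicative generalized Jordan `n`-derivation that vanishes at `0` is additive. -/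
lemma IsMulGenJordanDeriv.map_add {A : Type*} [Ring A] {n : ℕ} (hn : 2 ≤ n)
    (h2 : ∀ t : A, 2 * t = 0 → t = 0) {e : A} (hee : e * e = e) (hsp : Spade e)
    {Δ δ : A → A} (hΔ : IsMulGenJordanDeriv n Δ δ) (hΔ0 : Δ 0 = 0) (x y : A) :
    Δ (x + y) = Δ x + Δ y := by
  obtain ⟨m, rfl⟩ := Nat.exists_eq_add_of_le' hn
  rw [← sub_eq_zero]
  refine eq_zero_of_jordanMul h2 hee hsp (T := fun x y => Δ (x + y) - (Δ x + Δ y))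
    (by simp [hΔ0]) (by simp [hΔ0]) (fun b x y => ?_) x y
  refine map_jordanMul_of_two_pow h2 m ((RingHom.id A).prod (RingHom.id A))
    (fun p => Δ (p.1 + p.2) - (Δ p.1 + Δ p.2)) (fun b p => ?_) b (x, y)
  obtain ⟨R, hR⟩ := exists_addMonoidHom_jordanFold δ (b :: List.replicate m 1)
  have h := hR Δ (by simpa using hΔ)
  have hp := h (p.1 + p.2)
  rw [_root_.map_add, _root_.map_add] at hp
  simp only [jordanFold_cons_replicate_one] at h hp
  simp [hp, h]
  noncomm_ring

/-- On a 2-torsion-free unital ring with a nontrivial idempotent satisfying (♠), every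
multiplicative generalized Jordan `n`-derivation `Δ` is additive; more precisely
`Δ(t) = μt + δ(t)` for some central `μ` and some (additive) Jordan `n`-derivation `δ`. -/
theorem stmt_3 {A : Type*} [Ring A] (n : ℕ) (hn : 2 ≤ n)
    (h2 : ∀ t : A, 2 * t = 0 → t = 0)
    (e₁ : A) (hidem : e₁ * e₁ = e₁) (he0 : e₁ ≠ 0) (he1 : e₁ ≠ 1)
    (hsp : Spade e₁)
    (Δ δ₀ : A → A) (hδ₀ : IsMulJordanDeriv n δ₀) (hΔ : IsMulGenJordanDeriv n Δ δ₀) :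
    (∀ x y : A, Δ (x + y) = Δ x + Δ y) ∧
    ∃ μ : A, ∃ δ : A → A,
      (∀ a : A, μ * a = a * μ) ∧
      (∀ x y : A, δ (x + y) = δ x + δ y) ∧
      IsMulJordanDeriv n δ ∧
      ∀ t : A, Δ t = μ * t + δ t := by
  have hgen := hδ₀.isMulGenJordanDeriv (by lia : 0 < n)
  have hD : ∀ b x, Δ (x * b + b * x) - δ₀ (x * b + b * x)
      = (Δ x - δ₀ x) * b + b * (Δ x - δ₀ x) := fun b x => by
    obtain ⟨m, rfl⟩ := Nat.exists_eq_add_of_le' hn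
    refine map_jordanMul_of_two_pow h2 m (RingHom.id A) (fun x => Δ x - δ₀ x)
      (fun b x => ?_) b x
    obtain ⟨R, hR⟩ := exists_addMonoidHom_jordanFold δ₀ (b :: List.replicate m 1)
    have h := hR Δ (by simpa using hΔ) x
    have h' := hR δ₀ (by simpa using hgen) x
    simp only [jordanFold_cons_replicate_one] at h h'
    simp only [RingHom.id_apply, h, h']
    noncomm_ring
  have hδ₀0 : δ₀ 0 = 0 := hδ₀.map_zero hn
  have hadd := hgen.map_add hn h2 hidem hsp hδ₀0
  have hscalar : ∀ b, 2 * (Δ b - δ₀ b) = (Δ 1 - δ₀ 1) * b + b * (Δ 1 - δ₀ 1) := fun b => by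
    have h := hD 1 b
    have h' := hD b 1
    rw [mul_one, one_mul] at h h'
    rw [← h', add_comm b b, h, mul_one, one_mul, two_mul]
  obtain ⟨d, hd⟩ : ∃ d, d = Δ 1 - δ₀ 1 := ⟨_, rfl⟩
  rw [← hd] at hscalar
  have hcentral : ∀ a, d * a = a * d := by
    refine commute_of_commutator_central hidem hsp fun b x => sub_eq_zero.1 ?_
    have h := hscalar (x * b + b * x)
    have h' : 2 * ((Δ x - δ₀ x) * b + b * (Δ x - δ₀ x))
        = 2 * (Δ x - δ₀ x) * b + b * (2 * (Δ x - δ₀ x)) := by noncomm_ring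
    rw [hD, h', hscalar] at h
    rw [← sub_eq_zero] at h
    rw [← neg_eq_zero, ← h]
    noncomm_ring
  have hΔeq : ∀ t, Δ t = d * t + δ₀ t := fun t => by
    rw [← sub_eq_iff_eq_add]
    refine sub_eq_zero.1 (h2 _ ?_)
    rw [mul_sub, hscalar, ← hcentral, two_mul, sub_self]
  refine ⟨fun x y => ?_, d, δ₀, hcentral, hadd, hδ₀, hΔeq⟩
  rw [hΔeq, hΔeq, hΔeq, hadd]
  noncomm_ring
end

section
/- Let n ≥ 2 be an integer and let A be a 2-torsion-free unital ring containing a nontrivial idempotent e₁ (e₁ ≠ 0 and e₁ ≠ 1) with e₂ = 1 − e₁ such that e₂Ae₁ = {0} and e₁Ae₂ is a faithful (e₁Ae₁, e₂Ae₂)-bimodule (i.e., e₁te₁·e₁Ae₂ = {0} implies e₁te₁ = 0, and e₁Ae₂·e₂te₂ = {0} implies e₂te₂ = 0), so that A is a triangular ring. Then every multiplicative generalized Jordan n-derivation Δ : A → A can be expressed as Δ(t) = μt + δ(t) for all t ∈ A, where μ lies in the center Z(A) and δ : A → A is a derivation. -/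
/-- The Jordan product `x∘y = xy + yx`. -/
def jord {A : Type*} [Ring A] (x y : A) : A := x * y + y * x

lemma jord_zero_right {A : Type*} [Ring A] (x : A) : jord x 0 = 0 := by simp [jord]

/-- The iterated product `(⋯(y∘w)∘⋯)∘w` with `k` factors `w`. -/
def jordIter {A : Type*} [Ring A] (w : A) : ℕ → A → A
  | 0, y => y
  | k + 1, y => jord (jordIter w k y) w

/-- The sum of the terms obtained from `(⋯(y∘w)∘⋯)∘w` (with `k` factors `w`) by replacing one
factor `w` by `v`. -/
def jordSum {A : Type*} [Ring A] (w v : A) : ℕ → A → A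
  | 0, _ => 0
  | k + 1, y => jord (jordSum w v k y) w + jord (jordIter w k y) v

/-- The Jordan `(k+2)`-derivation identity restricted to tuples `(a, b, w, …, w)`. -/
def IsJordanDerivOn {A : Type*} [Ring A] (k : ℕ) (D : A → A) : Prop :=
  ∀ a b w : A, D (jordIter w k (jord a b)) =
    jordIter w k (jord (D a) b + jord a (D b)) + jordSum w (D w) k (jord a b)

/-- Peirce data of a 2-torsion-free triangular ring. -/
structure IsTriangularPair {A : Type*} [Ring A] (e f : A) : Prop where
  add_eq_one : e + f = 1
  idem : e * e = e
  tri : ∀ a, f * (a * e) = 0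
  faithL : ∀ t, (∀ a, e * (t * (e * (a * f))) = 0) → e * (t * e) = 0
  faithR : ∀ t, (∀ a, e * (a * (f * (t * f))) = 0) → f * (t * f) = 0
  two_torsion : ∀ t : A, t + t = 0 → t = 0

section Lists

variable {A : Type*} [Ring A]

lemma jordanProd_cons_cons (a b : A) (l : List A) :
    jordanProd (a :: b :: l) = l.foldl jord (jord a b) := rfl

lemma jordIter_add (w x y : A) (k : ℕ) :
    jordIter w k (x + y) = jordIter w k x + jordIter w k y := by
  induction k with
  | zero => rfl
  | succ k ih =>
    simp only [jordIter, ih, jord]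
    noncomm_ring

lemma foldl_replicate_eq_jordIter (w y : A) (k : ℕ) :
    (List.replicate k w).foldl jord y = jordIter w k y := by
  induction k with
  | zero => rfl
  | succ k ih =>
    rw [List.replicate_succ', List.foldl_append, ih, jordIter]
    rfl

lemma sum_foldl_replicate_set (w v y : A) (k : ℕ) :
    ∑ i ∈ Finset.range k,
      ((List.replicate k w).set i v).foldl jord y = jordSum w v k y := by
  induction k with
  | zero => rfl
  | succ k ih =>
    rw [Finset.sum_range_succ, jordSum, ← ih]
    congr 1
    · simp only [jord, Finset.sum_mul, Finset.mul_sum, ← Finset.sum_add_distrib]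
      refine Finset.sum_congr rfl fun i hi => ?_
      have hi : i < k := Finset.mem_range.1 hi
      rw [List.replicate_succ', List.set_append_left _ _ (by simpa using hi), List.foldl_append]
      rfl
    · rw [List.replicate_succ', List.set_append_right _ _ (by simp), List.foldl_append,
        foldl_replicate_eq_jordIter]
      simp

lemma IsMulJordanDeriv.isJordanDerivOn {k : ℕ} {D : A → A} (hD : IsMulJordanDeriv (k + 2) D) :
    IsJordanDerivOn k D := by
  intro a b w
  have h := hD (a :: b :: List.replicate k w) (by simp)
  rw [Finset.sum_range_succ', Finset.sum_range_succ'] at h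
  have hsum : ∑ i ∈ Finset.range k, jordanProd ((a :: b :: List.replicate k w).set (i + 1 + 1)
      (D ((a :: b :: List.replicate k w).getD (i + 1 + 1) 0))) =
      jordSum w (D w) k (jord a b) := by
    rw [← sum_foldl_replicate_set]
    refine Finset.sum_congr rfl fun i hi => ?_
    have hi : i < k := Finset.mem_range.1 hi
    simp [jordanProd_cons_cons, hi]
  rw [hsum] at h
  simp only [jordanProd_cons_cons, List.set_cons_zero, List.set_cons_succ,
    List.getD_cons_zero, List.getD_cons_succ, zero_add, foldl_replicate_eq_jordIter] at h
  rw [jordIter_add, h]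
  abel

lemma IsMulGenJordanDeriv.sub_iterate {k : ℕ} {Δ D : A → A} (hD : IsMulJordanDeriv (k + 2) D)
    (hΔ : IsMulGenJordanDeriv (k + 2) Δ D) (a b w : A) :
    Δ (jordIter w k (jord a b)) - D (jordIter w k (jord a b)) =
      jordIter w k (jord (Δ a - D a) b) := by
  have h := hD (a :: b :: List.replicate k w) (by simp)
  have h' := hΔ (a :: b :: List.replicate k w) (by simp)
  rw [Finset.range_eq_Ico, Finset.sum_eq_sum_Ico_succ_bot (by lia)] at h
  have hs : jord (Δ a) b = jord (Δ a - D a) b + jord (D a) b := by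
    simp only [jord]; noncomm_ring
  simp only [jordanProd_cons_cons, List.set_cons_zero,
    List.getD_cons_zero, zero_add, foldl_replicate_eq_jordIter] at h h'
  rw [h, h']
  rw [hs, jordIter_add]
  abel

end Lists

section Iterates

variable {A : Type*} [Ring A]

lemma jordIter_zero (w : A) (k : ℕ) : jordIter w k 0 = 0 := by
  induction k with
  | zero => rfl
  | succ k ih => simp [jordIter, jord, ih]

lemma jordIter_one (y : A) (k : ℕ) : jordIter 1 k y = 2 ^ k • y := by
  induction k with
  | zero => simp [jordIter]
  | succ k ih =>
    rw [jordIter, ih]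
    simp only [jord, mul_one, one_mul]
    rw [← two_nsmul, smul_smul, pow_succ']

lemma jordSum_zero (w : A) (k : ℕ) (y : A) : jordSum w 0 k y = 0 := by
  induction k with
  | zero => rfl
  | succ k ih => simp [jordSum, jord, ih]

lemma jordSum_sub (w u v : A) (k : ℕ) (y : A) :
    jordSum w (u - v) k y = jordSum w u k y - jordSum w v k y := by
  induction k with
  | zero => simp [jordSum]
  | succ k ih =>
    simp only [jordSum, jord, ih]
    noncomm_ring

lemma two_nsmul_jordSum_one (c : A) (k : ℕ) (y : A) :
    2 • jordSum 1 c k y = (k * 2 ^ k) • jord y c := by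
  induction k with
  | zero => simp [jordSum]
  | succ k ih =>
    have : 2 • jordSum 1 c (k + 1) y =
        2 • (2 • jordSum 1 c k y) + (2 * 2 ^ k) • jord y c := by
      simp only [jordSum, jordIter_one]
      simp only [jord, mul_one, one_mul, smul_mul_assoc, mul_smul_comm]
      module
    rw [this, ih]
    module

/-- A derivation satisfies the identity exactly. -/
lemma jordIter_derivation {G : A → A} (hadd : ∀ x y, G (x + y) = G x + G y)
    (hmul : ∀ x y, G (x * y) = G x * y + x * G y) (w y : A) (k : ℕ) :
    G (jordIter w k y) = jordIter w k (G y) + jordSum w (G w) k y := by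
  induction k with
  | zero => simp [jordIter, jordSum]
  | succ k ih =>
    simp only [jordIter, jordSum]
    simp only [jord, hadd, hmul, ih]
    noncomm_ring

lemma jordIter_central {c : A} (hc : ∀ a, c * a = a * c) (w y : A) (k : ℕ) :
    jordIter w k (c * y) = c * jordIter w k y := by
  induction k with
  | zero => rfl
  | succ k ih =>
    simp only [jordIter, ih, jord, mul_add]
    rw [mul_assoc, ← mul_assoc w, ← hc w, mul_assoc]

lemma jordSum_central {c : A} (hc : ∀ a, c * a = a * c) (w y : A) (k : ℕ) :
    jordSum w (c * w) k y = k • (c * jordIter w k y) := by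
  induction k with
  | zero => simp [jordSum]
  | succ k ih =>
    simp only [jordSum, jordIter, ih, jord]
    set z := jordIter w k y
    have h1 : w * (c * z) = c * (w * z) := by rw [← mul_assoc, ← hc w, mul_assoc]
    have h2 : z * (c * w) = c * (z * w) := by rw [← mul_assoc, ← hc z, mul_assoc]
    simp only [smul_mul_assoc, mul_smul_comm, h1, h2, mul_assoc, mul_add]
    module

/-- Subtracting an inner derivation and a central multiplication killed by `k + 1`. -/
lemma IsJordanDerivOn.sub_inner_sub_central {k : ℕ} {D : A → A} (hD : IsJordanDerivOn k D)
    {c : A} (hc : ∀ a, c * a = a * c) (hk : (k + 1) • c = 0) (x : A) :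
    IsJordanDerivOn k fun t => D t - (t * x - x * t) - c * t := by
  intro a b w
  have hI := jordIter_derivation (G := fun t => t * x - x * t)
    (fun _ _ => by noncomm_ring) (fun _ _ => by noncomm_ring) w (jord a b) k
  have hC := jordIter_central hc w (jord a b) k
  have hS := jordSum_central hc w (jord a b) k
  have h1 : jord (D a - (a * x - x * a) - c * a) b + jord a (D b - (b * x - x * b) - c * b)
      + ((jord a b * x - x * jord a b) + (c * jord a b + c * jord a b)) =
      jord (D a) b + jord a (D b) := by
    have : a * (c * b) = c * (a * b) := by rw [← mul_assoc, ← hc a, mul_assoc]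
    have h' : b * (c * a) = c * (b * a) := by rw [← mul_assoc, ← hc b, mul_assoc]
    simp only [jord, mul_sub, sub_mul, mul_add, add_mul, this, h', mul_assoc]
    abel
  have h2 := congrArg (jordIter w k) h1
  simp only [jordIter_add, hC] at h2
  have h3 : (k + 1) • (c * jordIter w k (jord a b)) = 0 := by
    rw [← smul_mul_assoc, hk, zero_mul]
  rw [add_smul, one_smul] at h3
  simp only [jordSum_sub, jordIter_add] at hI ⊢
  rw [hD, jordIter_add, ← h2, hS, hI, ← sub_eq_zero]
  refine Eq.trans ?_ h3
  abel

end Iterates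

namespace IsTriangularPair

variable {A : Type*} [Ring A] {e f : A} (h : IsTriangularPair e f)

include h

lemma one_sub : f = 1 - e := eq_sub_of_add_eq' h.add_eq_one

lemma idem' : f * f = f := by
  rw [h.one_sub]; simp [mul_sub, sub_mul, h.idem]

lemma mul_right_zero : e * f = 0 := by
  rw [h.one_sub]; simp [mul_sub, h.idem]

lemma mul_left_zero : f * e = 0 := by
  rw [h.one_sub]; simp [sub_mul, h.idem]

lemma idem_assoc (a : A) : e * (e * a) = e * a := by rw [← mul_assoc, h.idem]

lemma idem'_assoc (a : A) : f * (f * a) = f * a := by rw [← mul_assoc, h.idem']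

lemma mul_right_zero_assoc (a : A) : e * (f * a) = 0 := by
  rw [← mul_assoc, h.mul_right_zero, zero_mul]

lemma mul_left_zero_assoc (a : A) : f * (e * a) = 0 := by
  rw [← mul_assoc, h.mul_left_zero, zero_mul]

lemma tri_assoc (a b : A) : f * (a * (e * b)) = 0 := by
  simpa [mul_assoc] using congrArg (· * b) (h.tri a)

lemma tri₂ (a b : A) : f * (a * (b * e)) = 0 := by
  simpa [mul_assoc] using h.tri (a * b)

lemma tri₂_assoc (a b c : A) : f * (a * (b * (e * c))) = 0 := by
  simpa [mul_assoc] using h.tri_assoc (a * b) c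

lemma tri₃ (a b c : A) : f * (a * (b * (c * e))) = 0 := by
  simpa [mul_assoc] using h.tri (a * (b * c))

lemma tri₃_assoc (a b c d : A) : f * (a * (b * (c * (e * d)))) = 0 := by
  simpa [mul_assoc] using h.tri_assoc (a * (b * c)) d

/-- The rewrite rules of the Peirce decomposition, for products associated to the right. -/
lemma rules : (e * e = e ∧ f * f = f ∧ e * f = 0 ∧ f * e = 0) ∧
    ((∀ a, e * (e * a) = e * a) ∧ (∀ a, f * (f * a) = f * a) ∧
      (∀ a, e * (f * a) = 0) ∧ (∀ a, f * (e * a) = 0)) ∧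
    ((∀ a, f * (a * e) = 0) ∧ (∀ a b, f * (a * (e * b)) = 0) ∧
      (∀ a b, f * (a * (b * e)) = 0) ∧ (∀ a b c, f * (a * (b * (e * c))) = 0) ∧
      (∀ a b c, f * (a * (b * (c * e))) = 0) ∧
      (∀ a b c d, f * (a * (b * (c * (e * d)))) = 0)) :=
  ⟨⟨h.idem, h.idem', h.mul_right_zero, h.mul_left_zero⟩,
    ⟨h.idem_assoc, h.idem'_assoc, h.mul_right_zero_assoc, h.mul_left_zero_assoc⟩,
    h.tri, h.tri_assoc, h.tri₂, h.tri₂_assoc, h.tri₃, h.tri₃_assoc⟩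

lemma peirce (x : A) : x = e * (x * e) + e * (x * f) + f * (x * f) := by
  have : x = (e + f) * (x * (e + f)) := by simp [h.add_eq_one]
  conv_lhs => rw [this]
  simp only [mul_add, add_mul, h.tri]
  abel

lemma mul_left_eq (x y : A) : x * (e * y) = e * (x * (e * y)) := by
  have := h.tri_assoc x y
  rwa [h.one_sub, sub_mul, one_mul, sub_eq_zero] at this

lemma mul_right_eq (x : A) : f * x = f * (x * f) := by
  conv_lhs => rw [← mul_one (f * x), ← h.add_eq_one, mul_add, mul_assoc, h.tri, zero_add, mul_assoc]

lemma eq_zero_of_peirce {x : A} (h₁ : e * (x * e) = 0) (h₂ : e * (x * f) = 0)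
    (h₃ : f * (x * f) = 0) : x = 0 := by
  rw [h.peirce x, h₁, h₂, h₃]; simp

lemma pow_two_torsion (k : ℕ) {x : A} (hx : 2 ^ k • x = 0) : x = 0 := by
  induction k with
  | zero => simpa using hx
  | succ k ih =>
    refine ih (h.two_torsion _ ?_)
    rw [← two_nsmul, smul_smul, ← pow_succ', hx]

lemma pow_two_cancel (k : ℕ) {x y : A} (hx : 2 ^ k • x = 2 ^ k • y) : x = y :=
  sub_eq_zero.1 (h.pow_two_torsion k (by rw [smul_sub, hx, sub_self]))

/-- An element commuting with `e` and with `eAf` is central. -/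
lemma central_of_commute {c : A} (hce : c * e = e * c)
    (hcm : ∀ a, c * (e * (a * f)) = e * (a * f) * c) (a : A) : c * a = a * c := by
  have hcf : c * f = f * c := by rw [h.one_sub, mul_sub, sub_mul, hce]; simp
  have ec : ∀ x, e * (c * x) = c * (e * x) := fun x => by
    rw [← mul_assoc, ← hce, mul_assoc]
  have fc : ∀ x, f * (c * x) = c * (f * x) := fun x => by
    rw [← mul_assoc, ← hcf, mul_assoc]
  refine sub_eq_zero.1 (h.eq_zero_of_peirce (h.faithL _ fun b => ?_) ?_ (h.faithR _ fun b => ?_))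
  · have h₁ := hcm (e * (a * (e * b)))
    have h₂ := hcm b
    simp only [mul_assoc, h.rules] at h₁ h₂
    simp only [sub_mul, mul_sub, mul_assoc, ec]
    rw [h₁, h₂, sub_self]
  · have h₁ := hcm a
    simp only [mul_assoc] at h₁
    simp only [sub_mul, mul_sub, mul_assoc, ec]
    rw [hcf, h₁, sub_self]
  · have h₁ := hcm (b * (f * (a * f)))
    have h₂ := hcm b
    simp only [mul_assoc, h.rules] at h₁ h₂
    have h₃ := congrArg (· * (a * f)) h₂
    simp only [mul_assoc, fc] at h₃
    simp only [sub_mul, mul_sub, mul_assoc, fc]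
    rw [hcf, ← h₃, ← h₁, sub_self]

/-- If all commutators with `μ` are central then `μ` is central. -/
lemma central_of_commutator_central {μ : A}
    (hμ : ∀ a b, a * (μ * b - b * μ) = (μ * b - b * μ) * a) (a : A) : μ * a = a * μ := by
  have off : ∀ z, (∀ a, a * (e * (z * f)) = e * (z * f) * a) → e * (z * f) = 0 := fun z hz => by
    simpa only [mul_assoc, h.rules, mul_zero] using hz e
  have he : μ * e - e * μ = - (e * (μ * f)) := by
    have h₁ := h.tri μ
    rw [h.one_sub] at h₁ ⊢
    simp only [sub_mul, mul_sub, one_mul, mul_one, sub_eq_zero] at h₁ ⊢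
    rw [← h₁]; abel
  refine h.central_of_commute (sub_eq_zero.1 ?_) (fun b => sub_eq_zero.1 ?_) a
  · rw [he, neg_eq_zero]
    refine off _ fun a => ?_
    have := hμ a e
    rw [he] at this
    simpa using this
  · have hm : μ * (e * (b * f)) - e * (b * f) * μ =
        e * ((μ * (e * (b * f)) - b * (f * μ)) * f) := by
      simp only [sub_mul, mul_sub, mul_assoc, h.rules, ← h.mul_left_eq, ← h.mul_right_eq]
    rw [hm]
    exact off _ fun a => by rw [← hm]; exact hμ a _

lemma jord_off (t a : A) :
    jord t (e * (a * f)) = e * ((t * (e * a) + a * (f * t)) * f) := by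
  simp only [jord, add_mul, mul_add, mul_assoc]
  rw [← h.mul_right_eq, ← h.mul_left_eq]

lemma jordIter_right_diag (k : ℕ) (y : A) :
    f * (jordIter f k y * f) = 2 ^ k • (f * (y * f)) := by
  induction k with
  | zero => simp [jordIter]
  | succ k ih =>
    simp only [jordIter, jord, add_mul, mul_add, mul_assoc, h.rules, ih, mul_smul_comm]
    module

lemma jordIter_left_off (k : ℕ) (y : A) : e * (jordIter e k y * f) = e * (y * f) := by
  induction k with
  | zero => rfl
  | succ k ih =>
    simp only [jordIter, jord, add_mul, mul_assoc, h.rules, ih, mul_zero, zero_add]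

lemma jordIter_left_diag (k : ℕ) (y : A) :
    e * (jordIter e k y * e) = 2 ^ k • (e * (y * e)) := by
  induction k with
  | zero => simp [jordIter]
  | succ k ih =>
    simp only [jordIter, jord, add_mul, mul_add, mul_assoc, h.rules, ih, mul_smul_comm]
    module

lemma jordIter_left_of_off (k : ℕ) (y : A) : jordIter e k (e * (y * f)) = e * (y * f) := by
  induction k with
  | zero => rfl
  | succ k ih => simp only [jordIter, jord, ih, mul_assoc, h.rules, mul_zero, zero_add]

lemma jordIter_right_of_off (k : ℕ) (y : A) : jordIter f k (e * (y * f)) = e * (y * f) := by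
  induction k with
  | zero => rfl
  | succ k ih => simp only [jordIter, jord, ih, mul_assoc, h.rules, add_zero]

end IsTriangularPair

namespace IsJordanDerivOn

variable {A : Type*} [Ring A] {e f : A} {k : ℕ} {D : A → A}

lemma map_zero (hD : IsJordanDerivOn k D) : D 0 = 0 := by
  have h := hD 0 0 0
  have hS : ∀ j, jordSum 0 (D 0) j 0 = 0 := fun j => by
    cases j <;> simp [jordSum, jord, jordIter_zero]
  simpa [jord, jordIter_zero, hS] using h

lemma two_nsmul_map (hD : IsJordanDerivOn k D) (a b : A) :
    2 • D (2 ^ k • jord a b) = (2 * 2 ^ k) • (jord (D a) b + jord a (D b)) +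
      (k * 2 ^ k) • jord (jord a b) (D 1) := by
  rw [← two_nsmul_jordSum_one, mul_smul, ← smul_add, ← jordIter_one, ← jordIter_one, hD]

lemma map_idempotent (h : IsTriangularPair e f) (hD : IsJordanDerivOn k D) {p : A}
    (hp : p * p = p) : 2 • D p + jord p (D 1) = 2 • jord p (D p) := by
  have h₁ := hD.two_nsmul_map p 1
  have h₂ := hD.two_nsmul_map p p
  have hj : jord p 1 = jord p p := by simp [jord, hp]
  rw [hj, h₂] at h₁
  apply h.pow_two_cancel (k + 1)
  rw [pow_succ', two_nsmul (D p), two_nsmul (jord p (D p))]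
  simp only [jord, mul_one, one_mul] at h₁ ⊢
  rw [← add_right_cancel h₁]
  congr 1
  abel

lemma map_left (h : IsTriangularPair e f) (hD : IsJordanDerivOn k D) :
    e * (D e * e) = e * (D 1 * e) ∧ e * (D 1 * f) = 0 ∧ f * (D e * f) = 0 := by
  have hp := hD.map_idempotent h h.idem
  simp only [two_nsmul, jord] at hp
  refine ⟨?_, ?_, ?_⟩
  · have := congrArg (fun z => e * (z * e)) hp
    simp only [add_mul, mul_add, mul_assoc, h.rules] at this
    apply sub_eq_zero.1
    apply h.two_torsion
    rw [← sub_eq_zero] at this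
    rw [← neg_eq_zero, ← this]
    abel
  · have := congrArg (fun z => e * (z * f)) hp
    simp only [add_mul, mul_add, mul_assoc, h.rules] at this
    simpa using this
  · have := congrArg (fun z => f * (z * f)) hp
    simp only [add_mul, mul_add, mul_assoc, h.rules] at this
    exact h.two_torsion _ (by simpa using this)

lemma map_right (h : IsTriangularPair e f) (hD : IsJordanDerivOn k D) :
    f * (D f * f) = f * (D 1 * f) ∧ e * (D f * e) = 0 := by
  have hp := hD.map_idempotent h h.idem'
  simp only [two_nsmul, jord] at hp
  refine ⟨?_, ?_⟩
  · have := congrArg (fun z => f * (z * f)) hp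
    simp only [add_mul, mul_add, mul_assoc, h.rules] at this
    apply sub_eq_zero.1
    apply h.two_torsion
    rw [← sub_eq_zero] at this
    rw [← neg_eq_zero, ← this]
    abel
  · have := congrArg (fun z => e * (z * e)) hp
    simp only [add_mul, mul_add, mul_assoc, h.rules] at this
    exact h.two_torsion _ (by simpa using this)

lemma map_left_add_map_right (h : IsTriangularPair e f) (hD : IsJordanDerivOn k D) :
    e * (D f * f) = - (e * (D e * f)) := by
  have h₁ := hD.two_nsmul_map e f
  have hj : jord e f = 0 := by simp [jord, h.rules]
  simp only [hj, smul_zero, hD.map_zero] at h₁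
  rw [← pow_succ', jord.eq_def 0] at h₁
  simp only [zero_mul, mul_zero, add_zero, smul_zero] at h₁
  have := congrArg (fun z => e * (z * f)) (h.pow_two_torsion _ h₁.symm)
  simp only [jord, add_mul, mul_add, mul_assoc, h.rules] at this
  rw [eq_neg_iff_add_eq_zero]
  simpa [add_comm] using this

lemma map_eq_left (h : IsTriangularPair e f) (hD : IsJordanDerivOn k D) :
    D e = e * (D 1 * e) + e * (D e * f) := by
  obtain ⟨h₁, -, h₂⟩ := hD.map_left h
  conv_lhs => rw [h.peirce (D e), h₁, h₂, add_zero]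

lemma map_eq_right (h : IsTriangularPair e f) (hD : IsJordanDerivOn k D) :
    D f = f * (D 1 * f) - e * (D e * f) := by
  obtain ⟨h₁, h₂⟩ := hD.map_right h
  conv_lhs => rw [h.peirce (D f), h₁, h₂, hD.map_left_add_map_right h]
  abel

lemma map_off (h : IsTriangularPair e f) (hD : IsJordanDerivOn k D) (a : A) :
    D (e * (a * f)) = e * (D (e * (a * f)) * f) ∧
      D 1 * (e * (a * f)) = e * (a * f) * D 1 := by
  have h₁ := hD.two_nsmul_map (e * (a * f)) e
  have h₂ := hD.two_nsmul_map (e * (a * f)) f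
  have hj : jord (e * (a * f)) e = jord (e * (a * f)) f := by
    simp [jord, mul_assoc, h.rules]
  rw [hj, h₂, ← pow_succ'] at h₁
  have h₃ := h.pow_two_cancel _ (add_right_cancel h₁)
  rw [hD.map_eq_left h, hD.map_eq_right h] at h₃
  generalize D (e * (a * f)) = y at *
  simp only [jord, mul_add, add_mul, mul_sub, sub_mul, mul_assoc, h.rules, mul_zero, add_zero,
    sub_zero] at h₃
  have hee := congrArg (fun z => e * (z * e)) h₃
  have hef := congrArg (fun z => e * (z * f)) h₃
  have hff := congrArg (fun z => f * (z * f)) h₃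
  simp only [mul_add, add_mul, mul_assoc, h.rules, mul_zero, add_zero, zero_add] at hee hef hff
  have hc := (hD.map_left h).2.1
  refine ⟨?_, ?_⟩
  · conv_lhs => rw [h.peirce y, h.two_torsion _ hee.symm, h.two_torsion _ hff]
    abel
  · have hl : D 1 * e = e * (D 1 * e) := by
      have := h.peirce (D 1 * e)
      simpa [mul_assoc, h.rules] using this
    have hr : f * D 1 = f * (D 1 * f) := by
      have := h.peirce (f * D 1)
      simpa [mul_assoc, h.rules] using this
    rw [← mul_assoc, hl, mul_assoc, mul_assoc, mul_assoc e, mul_assoc a, hr]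
    exact (add_left_cancel hef).symm

lemma map_one_central (h : IsTriangularPair e f) (hD : IsJordanDerivOn k D) (a : A) :
    D 1 * a = a * D 1 := by
  refine h.central_of_commute ?_ (fun a => (hD.map_off h a).2) a
  have h₁ := h.peirce (D 1 * e)
  have h₂ := h.peirce (e * D 1)
  simp only [mul_assoc, h.rules, (hD.map_left h).2.1, mul_zero, add_zero] at h₁ h₂
  rw [h₁, h₂]

lemma succ_nsmul_map_one (h : IsTriangularPair e f) (hD : IsJordanDerivOn k D) :
    (k + 1) • D 1 = 0 := by
  have hc := hD.map_one_central h
  have key : ∀ a, (k + 1) • (D 1 * (e * (a * f))) = 0 := fun a => by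
    have h₁ := hD (e * (a * f)) e e
    have hj : jord (e * (a * f)) e = e * (a * f) := by simp [jord, mul_assoc, h.rules]
    have hcm : D 1 * (e * (a * f)) = e * (D 1 * a * f) := by
      rw [← mul_assoc, hc, mul_assoc, mul_assoc]
    have hm : ∀ b, jord (e * (b * f)) (D e) = D 1 * (e * (b * f)) := fun b => by
      rw [hD.map_eq_left h, hc e]
      simp only [jord, mul_add, add_mul, mul_assoc, h.rules, mul_zero, zero_add, add_zero]
      rw [← mul_assoc e (D 1), ← hc e]; simp only [mul_assoc, h.rules]
    have hS : ∀ j, jordSum e (D e) j (e * (a * f)) = j • (D 1 * (e * (a * f))) := fun j => by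
      induction j with
      | zero => simp [jordSum]
      | succ j ih =>
        rw [jordSum, ih, h.jordIter_left_of_off, hm, hcm]
        simp only [jord, smul_mul_assoc, mul_smul_comm, mul_assoc, h.rules, mul_zero, smul_zero,
          zero_add]
        module
    have hd : jord (D (e * (a * f))) e = D (e * (a * f)) := by
      rw [(hD.map_off h a).1]; simp [jord, mul_assoc, h.rules]
    have hT : jordIter e k (D (e * (a * f))) = D (e * (a * f)) := by
      rw [(hD.map_off h a).1, h.jordIter_left_of_off]
    have hT' : jordIter e k (D 1 * (e * (a * f))) = D 1 * (e * (a * f)) := by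
      rw [hcm, h.jordIter_left_of_off]
    rw [hj, h.jordIter_left_of_off, hS, hm, hd, jordIter_add, hT, hT', add_assoc,
      left_eq_add] at h₁
    rw [add_smul, one_smul, add_comm, h₁]
  have hz : ∀ a, ((k + 1) • D 1) * a = a * ((k + 1) • D 1) := fun a => by
    rw [smul_mul_assoc, hc, mul_smul_comm]
  simp only [← smul_mul_assoc] at key
  generalize (k + 1) • D 1 = z at *
  refine h.eq_zero_of_peirce (h.faithL _ fun a => ?_) ?_ (h.faithR _ fun a => ?_)
  · rw [key, mul_zero]
  · rw [← mul_assoc, ← hz, mul_assoc, h.mul_right_zero, mul_zero]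
  · have := key a
    rw [hz] at this
    rw [hz f, h.idem'_assoc]
    simpa only [mul_assoc] using this

end IsJordanDerivOn

/-- A multiplicative Jordan derivation in the sense of `IsJordanDerivOn` vanishing on the
Peirce idempotents. -/
structure IsNormalized {A : Type*} [Ring A] (e f : A) (k : ℕ) (G : A → A) : Prop where
  deriv : IsJordanDerivOn k G
  map_one : G 1 = 0
  map_left : G e = 0
  map_right : G f = 0

namespace IsNormalized

variable {A : Type*} [Ring A] {e f : A} {k : ℕ} {G : A → A}

lemma map_jordIter_left (hG : IsNormalized e f k G) (a b : A) :
    G (jordIter e k (jord a b)) = jordIter e k (jord (G a) b + jord a (G b)) := by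
  rw [hG.deriv, hG.map_left, jordSum_zero, add_zero]

lemma map_jordIter_right (hG : IsNormalized e f k G) (a b : A) :
    G (jordIter f k (jord a b)) = jordIter f k (jord (G a) b + jord a (G b)) := by
  rw [hG.deriv, hG.map_right, jordSum_zero, add_zero]

lemma map_pow_smul_jord (hG : IsNormalized e f k G) (a b : A) :
    G (2 ^ k • jord a b) = 2 ^ k • (jord (G a) b + jord a (G b)) := by
  rw [← jordIter_one, ← jordIter_one, hG.deriv, hG.map_one, jordSum_zero, add_zero]

lemma off_eq (h : IsTriangularPair e f) (hG : IsNormalized e f k G) (a : A) :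
    G (e * (a * f)) = e * (G (e * (a * f)) * f) := (hG.deriv.map_off h a).1

lemma map_jord_of_off (h : IsTriangularPair e f) (hG : IsNormalized e f k G) {x y a : A}
    (hj : jord x y = e * (a * f)) :
    G (e * (a * f)) = jord (G x) y + jord x (G y) := by
  have hl := hG.map_jordIter_left x y
  have hr := hG.map_jordIter_right x y
  rw [hj, h.jordIter_left_of_off, hG.off_eq h] at hl
  rw [hj, h.jordIter_right_of_off, hG.off_eq h] at hr
  have h₁ := congrArg (fun z => e * (z * e)) hl
  have h₂ := congrArg (fun z => e * (z * f)) hl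
  have h₃ := congrArg (fun z => f * (z * f)) hr
  simp only [h.jordIter_left_off, h.jordIter_left_diag, h.jordIter_right_diag, mul_assoc, h.rules,
    mul_zero] at h₁ h₂ h₃
  rw [h.peirce (jord (G x) y + jord x (G y)), h.pow_two_torsion k h₁.symm,
    h.pow_two_torsion k h₃.symm, ← h₂, zero_add, add_zero, ← hG.off_eq h]

lemma map_left_add (h : IsTriangularPair e f) (hG : IsNormalized e f k G) (a : A) :
    G (e + e * (a * f)) = G (e * (a * f)) := by
  have hp := hG.map_jord_of_off h (x := e + e * (a * f)) (y := f) (a := a)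
    (by simp [jord, add_mul, mul_add, mul_assoc, h.rules])
  have hq := fun b => hG.map_jord_of_off h (x := e + e * (a * f)) (y := e * (b * f)) (a := b)
    (by simp [jord, add_mul, mul_add, mul_assoc, h.rules])
  have hoff := hG.off_eq h
  generalize G (e + e * (a * f)) = p at *
  rw [hG.map_right] at hp
  rw [hoff] at hp ⊢
  have h₂ := congrArg (fun z => e * (z * f)) hp
  have h₃ := congrArg (fun z => f * (z * f)) hp
  simp only [jord, add_mul, mul_add, mul_assoc, h.rules, mul_zero, zero_mul, add_zero] at h₂ h₃
  replace h₃ := h.two_torsion _ h₃.symm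
  have h₁ : e * (p * e) = 0 := h.faithL _ fun b => by
    have := hq b
    rw [hoff] at this
    have := congrArg (fun z => e * (z * f)) this
    simp only [jord, add_mul, mul_add, mul_assoc, h.rules, mul_zero, add_zero] at this
    simpa only [h₃, mul_zero, add_zero, right_eq_add] using this
  rw [h.peirce p, h₁, h₃, h₂, zero_add, add_zero]

lemma map_right_add (h : IsTriangularPair e f) (hG : IsNormalized e f k G) (a : A) :
    G (f + e * (a * f)) = G (e * (a * f)) := by
  have hp := hG.map_jord_of_off h (x := f + e * (a * f)) (y := e) (a := a)
    (by simp [jord, add_mul, mul_add, mul_assoc, h.rules])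
  have hq := fun b => hG.map_jord_of_off h (x := f + e * (a * f)) (y := e * (b * f)) (a := b)
    (by simp [jord, add_mul, mul_add, mul_assoc, h.rules])
  have hoff := hG.off_eq h
  generalize G (f + e * (a * f)) = p at *
  rw [hG.map_left] at hp
  rw [hoff] at hp ⊢
  have h₂ := congrArg (fun z => e * (z * f)) hp
  have h₁ := congrArg (fun z => e * (z * e)) hp
  simp only [jord, add_mul, mul_add, mul_assoc, h.rules, mul_zero, zero_mul, add_zero,
    zero_add] at h₂ h₁
  replace h₁ := h.two_torsion _ h₁.symm
  have h₃ : f * (p * f) = 0 := h.faithR _ fun b => by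
    have := hq b
    rw [hoff] at this
    have := congrArg (fun z => e * (z * f)) this
    simp only [jord, add_mul, mul_add, mul_assoc, h.rules, mul_zero, add_zero] at this
    have hz : e * (p * (e * (b * f))) = 0 := by
      simpa only [mul_assoc, zero_mul] using congrArg (· * (b * f)) h₁
    simpa only [hz, zero_mul, mul_zero, zero_add, right_eq_add] using this
  rw [h.peirce p, h₁, h₃, h₂, zero_add, add_zero]

lemma map_off_add (h : IsTriangularPair e f) (hG : IsNormalized e f k G) (a b : A) :
    G (e * ((a + b) * f)) = G (e * (a * f)) + G (e * (b * f)) := by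
  rw [hG.map_jord_of_off h (x := e + e * (a * f)) (y := f + e * (b * f))
    (by simp [jord, add_mul, mul_add, mul_assoc, h.rules, add_comm]),
    hG.map_left_add h, hG.map_right_add h, hG.off_eq h a, hG.off_eq h b]
  simp [jord, add_mul, mul_add, mul_assoc, h.rules]

lemma two_mul_map_add_self (h : IsTriangularPair e f) (hG : IsNormalized e f k G) (a : A) :
    2 • G (a + a) = 4 • G a + jord a (G (1 + 1)) := by
  have h₁ := hG.map_pow_smul_jord a (1 + 1)
  have h₂ := hG.map_pow_smul_jord (a + a) 1
  have hj : jord a (1 + 1) = jord (a + a) 1 := by simp [jord, mul_add, add_mul]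
  rw [hj, h₂, hG.map_one] at h₁
  have := h.pow_two_cancel k h₁
  simp only [jord, mul_one, one_mul, mul_zero, zero_mul, mul_add, add_mul, add_zero] at this ⊢
  rw [two_nsmul, this]
  abel

lemma map_add_self (h : IsTriangularPair e f) (hG : IsNormalized e f k G) (a : A) :
    G (a + a) = G a + G a := by
  have hoff : ∀ b, G (e * (b * f) + e * (b * f)) = G (e * (b * f)) + G (e * (b * f)) := fun b => by
    rw [← hG.map_off_add h]; simp [add_mul, mul_add]
  have he : G (e + e) = 0 := by
    have h₁ := hG.map_jord_of_off h (x := e + e) (y := f) (a := 0)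
      (by simp [jord, add_mul, mul_add, h.rules])
    have h₂ := fun b => hG.map_jord_of_off h (x := e + e) (y := e * (b * f)) (a := b + b)
      (by simp [jord, add_mul, mul_add, mul_assoc, h.rules])
    have hz := hG.deriv.map_zero
    simp only [zero_mul, mul_zero, hz, hG.map_right, jord, add_zero] at h₁
    have h₁₂ := congrArg (fun z => e * (z * f)) h₁
    have h₂₂ := congrArg (fun z => f * (z * f)) h₁
    simp only [add_mul, mul_add, mul_assoc, h.rules, mul_zero, zero_mul, add_zero] at h₁₂ h₂₂
    refine h.eq_zero_of_peirce (h.faithL _ fun b => ?_) h₁₂.symm (h.two_torsion _ h₂₂.symm)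
    have := h₂ b
    rw [hG.map_off_add h, hG.off_eq h b] at this
    have := congrArg (fun z => e * (z * f)) this
    simp only [jord, add_mul, mul_add, mul_assoc, h.rules, mul_zero, add_zero] at this
    have hz := h.two_torsion _ h₂₂.symm
    simpa only [hz, mul_zero, add_zero, right_eq_add] using this
  have hu : G (1 + 1) = 0 := by
    have h₁ := hG.two_mul_map_add_self h e
    have h₂ := fun b => hG.two_mul_map_add_self h (e * (b * f))
    rw [he, hG.map_left, smul_zero, smul_zero, zero_add] at h₁
    simp only [hoff] at h₂
    have h₁₁ := congrArg (fun z => e * (z * e)) h₁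
    have h₁₂ := congrArg (fun z => e * (z * f)) h₁
    simp only [jord, add_mul, mul_add, mul_assoc, h.rules, mul_zero, zero_mul, add_zero] at h₁₁ h₁₂
    refine h.eq_zero_of_peirce (h.two_torsion _ h₁₁.symm) h₁₂.symm (h.faithR _ fun b => ?_)
    have h₃ : 2 • (G (e * (b * f)) + G (e * (b * f))) = 4 • G (e * (b * f)) := by abel
    have h₄ := h₂ b
    rw [h₃, left_eq_add] at h₄
    have hz : e * (G (1 + 1) * (e * (b * f))) = 0 := by
      simpa only [mul_assoc, zero_mul] using congrArg (· * (b * f)) (h.two_torsion _ h₁₁.symm)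
    simpa only [jord, add_mul, mul_add, mul_assoc, h.rules, mul_zero, zero_mul, hz, add_zero,
      zero_add] using congrArg (fun z => e * (z * f)) h₄
  have := hG.two_mul_map_add_self h a
  rw [hu] at this
  refine h.pow_two_cancel 1 ?_
  rw [pow_one, this, jord, mul_zero, zero_mul]
  abel

lemma map_jord (h : IsTriangularPair e f) (hG : IsNormalized e f k G) (a b : A) :
    G (jord a b) = jord (G a) b + jord a (G b) := by
  have hpow : ∀ (j : ℕ) (x : A), G (2 ^ j • x) = 2 ^ j • G x := fun j x => by
    induction j with
    | zero => simp
    | succ j ih => rw [pow_succ', mul_smul, two_nsmul, hG.map_add_self h, ih, mul_smul, two_nsmul]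
  refine h.pow_two_cancel k ?_
  rw [← hG.map_pow_smul_jord, hpow]

lemma map_off_part (h : IsTriangularPair e f) (hG : IsNormalized e f k G) (t : A) :
    G (e * (t * f)) = e * (G t * f) := by
  have := hG.map_jord_of_off h (x := jord t e) (y := f) (a := t)
    (by simp [jord, add_mul, mul_add, mul_assoc, h.rules])
  rw [this, hG.map_jord h, hG.map_left, hG.map_right]
  simp [jord, add_mul, mul_add, mul_assoc, h.rules]

lemma map_add (h : IsTriangularPair e f) (hG : IsNormalized e f k G) (s t : A) :
    G (s + t) = G s + G t := by
  have key : ∀ (s t a : A), jord (G (s + t) - (G s + G t)) (e * (a * f)) = 0 := fun s t a => by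
    have h₁ : jord (s + t) (e * (a * f)) =
        e * ((s * (e * a) + a * (f * s) + (t * (e * a) + a * (f * t))) * f) := by
      rw [h.jord_off]; simp only [mul_add, add_mul]; abel_nf
    have h₂ := hG.map_jord h (s + t) (e * (a * f))
    rw [h₁, hG.map_off_add h, ← h.jord_off, ← h.jord_off, hG.map_jord h, hG.map_jord h,
      ← sub_eq_zero] at h₂
    rw [← neg_eq_zero, ← h₂]
    simp only [jord, add_mul, mul_add, sub_mul, mul_sub]
    abel
  have key' := fun a => key (jord s e) (jord t e) a
  have hj : jord s e + jord t e = jord (s + t) e := by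
    simp only [jord, add_mul, mul_add]; abel
  have hz : jord (G (s + t)) e - (jord (G s) e + jord (G t) e) =
      jord (G (s + t) - (G s + G t)) e := by
    simp only [jord, add_mul, mul_add, sub_mul, mul_sub]; abel
  simp only [hj, hG.map_jord h _ e, hG.map_left, jord_zero_right, add_zero, hz] at key'
  have hoff : e * ((G (s + t) - (G s + G t)) * f) = 0 := by
    have := hG.map_off_add h s t
    simp only [hG.map_off_part h] at this
    rw [sub_mul, mul_sub, this, add_mul, mul_add, sub_self]
  have key₀ := key s t
  rw [← sub_eq_zero]
  generalize G (s + t) - (G s + G t) = z at *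
  have h₁ : ∀ a, e * (z * (e * (a * f))) = 0 := fun a => by
    have := congrArg (fun z => e * (z * f)) (key' a)
    simp only [jord, add_mul, mul_add, mul_assoc, h.rules, mul_zero, zero_mul, add_zero] at this
    exact h.two_torsion _ this
  refine h.eq_zero_of_peirce (h.faithL _ h₁) hoff (h.faithR _ fun a => ?_)
  have := congrArg (fun z => e * (z * f)) (key₀ a)
  simpa only [jord, add_mul, mul_add, mul_assoc, h.rules, mul_zero, zero_mul, h₁, zero_add]
    using this

lemma map_mul_off (h : IsTriangularPair e f) (hG : IsNormalized e f k G) (t a : A) :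
    G (t * (e * (a * f))) = G t * (e * (a * f)) + t * G (e * (a * f)) := by
  have h₁ := hG.map_jord h (jord t e) (e * (a * f))
  have hj : ∀ s b, jord (jord s e) (e * (b * f)) = s * (e * (b * f)) + s * (e * (b * f)) := by
    intro s b
    simp only [jord, add_mul, mul_add, mul_assoc, h.rules, mul_zero, add_zero]
    rw [← h.mul_left_eq]
  rw [hG.map_jord h t, hG.map_left, hG.off_eq h a, jord_zero_right, add_zero, hj, hj, hj,
    hG.map_add h] at h₁
  rw [hG.off_eq h a]
  refine h.pow_two_cancel 1 ?_
  rw [pow_one, two_nsmul, h₁]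
  abel

lemma map_off_mul (h : IsTriangularPair e f) (hG : IsNormalized e f k G) (t a : A) :
    G (e * (a * f) * t) = G (e * (a * f)) * t + e * (a * f) * G t := by
  have h₁ := hG.map_jord h (jord t f) (e * (a * f))
  have hj : ∀ s b, jord (jord s f) (e * (b * f)) = e * (b * f) * s + e * (b * f) * s := by
    intro s b
    simp only [jord, add_mul, mul_add, mul_assoc, h.rules, mul_zero, zero_add]
    rw [← h.mul_right_eq]
  rw [hG.map_jord h t, hG.map_right, hG.off_eq h a, jord_zero_right, add_zero, hj, hj, hj,
    hG.map_add h] at h₁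
  rw [hG.off_eq h a]
  refine h.pow_two_cancel 1 ?_
  rw [pow_one, two_nsmul, h₁]
  abel

lemma map_mul (h : IsTriangularPair e f) (hG : IsNormalized e f k G) (a b : A) :
    G (a * b) = G a * b + a * G b := by
  rw [← sub_eq_zero]
  refine h.eq_zero_of_peirce (h.faithL _ fun c => ?_) ?_ (h.faithR _ fun c => ?_)
  · have h₁ := hG.map_mul_off h (a * b) c
    have hb : b * (e * (c * f)) = e * ((b * (e * c)) * f) := by
      rw [h.mul_left_eq]; simp only [mul_assoc]
    rw [mul_assoc, hb, hG.map_mul_off h, ← hb, hG.map_mul_off h] at h₁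
    rw [sub_mul, add_mul, mul_assoc (G a), mul_assoc a (G b), sub_eq_zero.2, mul_zero]
    rw [← add_left_inj (a * b * G (e * (c * f))), ← h₁]
    simp only [mul_add, mul_assoc]
    abel
  · have hab : ∀ a b, e * (a * b * f) = a * (e * (b * f)) + e * (a * f) * b := fun a b => by
      rw [h.mul_left_eq a]
      simp only [mul_assoc]
      rw [h.mul_right_eq b, ← mul_add, ← mul_add, ← add_mul, h.add_eq_one, one_mul]
    rw [sub_mul, mul_sub, ← hG.map_off_part h, hab a b, hG.map_add h, hG.map_mul_off h,
      hG.map_off_mul h, hG.map_off_part h, hG.map_off_part h]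
    rw [add_mul, mul_add, hab (G a) b, hab a (G b)]
    abel
  · have h₁ := hG.map_off_mul h (a * b) c
    have ha : e * (c * f) * a = e * ((c * (f * a)) * f) := by
      simp only [mul_assoc]; rw [h.mul_right_eq]
    rw [← mul_assoc, ha, hG.map_off_mul h, ← ha, hG.map_off_mul h] at h₁
    have h₂ : e * (c * f) * (G (a * b) - (G a * b + a * G b)) = 0 := by
      rw [mul_sub, sub_eq_zero, ← add_right_inj (G (e * (c * f)) * (a * b)), ← h₁]
      simp only [mul_add, add_mul, mul_assoc]
      abel
    rw [← h.mul_right_eq]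
    simpa only [mul_assoc] using h₂

end IsNormalized

lemma IsJordanDerivOn.exists_derivation_add_central {A : Type*} [Ring A] {e f : A} {k : ℕ}
    (h : IsTriangularPair e f) {D : A → A} (hD : IsJordanDerivOn k D) :
    ∃ c : A, ∃ δ : A → A, (∀ a, c * a = a * c) ∧ (∀ x y, δ (x + y) = δ x + δ y) ∧
      (∀ x y, δ (x * y) = δ x * y + x * δ y) ∧ ∀ t, D t = c * t + δ t := by
  have hc := hD.map_one_central h
  set x := e * (D e * f) with hx
  let G := fun t => D t - (t * x - x * t) - D 1 * t
  have hG : IsNormalized e f k G :=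
    { deriv := hD.sub_inner_sub_central hc (hD.succ_nsmul_map_one h) x
      map_one := by simp [G]
      map_left := by
        simp only [G]
        rw [hD.map_eq_left h, ← hx, hc, ← mul_assoc e, ← hc, hx]
        simp only [mul_assoc, h.rules, mul_zero, hc e]
        abel
      map_right := by
        simp only [G]
        rw [hD.map_eq_right h, ← hx, hc, hx]
        simp only [mul_assoc, h.rules]
        abel }
  refine ⟨D 1, fun t => G t + (t * x - x * t), hc, fun s t => ?_, fun s t => ?_, fun t => ?_⟩
  · simp only [hG.map_add h]; noncomm_ring
  · simp only [hG.map_mul h]; noncomm_ring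
  · simp only [G]; abel

lemma eq_central_mul_of_map_jordIter {A : Type*} [Ring A] {e f : A} {k : ℕ}
    (h : IsTriangularPair e f) {F : A → A}
    (hF : ∀ a b w, F (jordIter w k (jord a b)) = jordIter w k (jord (F a) b)) :
    (∀ a, F 1 * a = a * F 1) ∧ ∀ t, F t = F 1 * t := by
  have h₁ : ∀ a b, F (2 ^ k • jord a b) = 2 ^ k • jord (F a) b := fun a b => by
    rw [← jordIter_one, hF, jordIter_one]
  have h₂ : ∀ t, F t + F t = jord (F 1) t := fun t => by
    have h₃ := h₁ t 1
    have h₄ := h₁ 1 t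
    have hj : jord t 1 = jord 1 t := by simp [jord]
    rw [hj, h₄] at h₃
    simpa [jord] using (h.pow_two_cancel k h₃).symm
  have hcomm : ∀ a b, a * (F 1 * b - b * F 1) = (F 1 * b - b * F 1) * a := fun a b => by
    have h₃ := h₂ (2 ^ k • jord a b)
    rw [h₁, ← smul_add] at h₃
    have h₄ : jord (F 1) (2 ^ k • jord a b) = 2 ^ k • jord (F 1) (jord a b) := by
      generalize jord a b = y
      simp only [jord, smul_mul_assoc, mul_smul_comm, smul_add]
    rw [h₄] at h₃
    have h₅ := h.pow_two_cancel k h₃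
    have h₆ : jord (F a) b + jord (F a) b = jord (F a + F a) b := by
      simp only [jord, add_mul, mul_add]; abel
    rw [h₆, h₂] at h₅
    rw [← sub_eq_zero] at h₅ ⊢
    rw [← h₅]
    simp only [jord, mul_add, add_mul, mul_sub, sub_mul, mul_assoc]
    abel
  have hc := h.central_of_commutator_central hcomm
  refine ⟨hc, fun t => h.pow_two_cancel 1 ?_⟩
  rw [pow_one, two_nsmul, h₂, two_nsmul, jord, hc]

/-- On a 2-torsion-free triangular ring (a unital ring with a nontrivial idempotent `e₁`
such that `e₂Ae₁ = {0}` and `e₁Ae₂` is a faithful `(e₁Ae₁, e₂Ae₂)`-bimodule, where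
`e₂ = 1 - e₁`), every multiplicative generalized Jordan `n`-derivation has the form
`Δ(t) = μt + δ(t)` with `μ` central and `δ` a derivation. -/
theorem stmt_6 {A : Type*} [Ring A] (n : ℕ) (hn : 2 ≤ n)
    (h2 : ∀ t : A, 2 * t = 0 → t = 0)
    (e₁ : A) (hidem : e₁ * e₁ = e₁) (he0 : e₁ ≠ 0) (he1 : e₁ ≠ 1)
    (htri : ∀ a : A, (1 - e₁) * a * e₁ = 0)
    (hfaithL : ∀ t : A, (∀ a : A, e₁ * t * e₁ * (e₁ * a * (1 - e₁)) = 0) →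
      e₁ * t * e₁ = 0)
    (hfaithR : ∀ t : A, (∀ a : A, (e₁ * a * (1 - e₁)) * ((1 - e₁) * t * (1 - e₁)) = 0) →
      (1 - e₁) * t * (1 - e₁) = 0)
    (Δ δ₀ : A → A) (hδ₀ : IsMulJordanDeriv n δ₀) (hΔ : IsMulGenJordanDeriv n Δ δ₀) :
    ∃ μ : A, ∃ δ : A → A,
      (∀ a : A, μ * a = a * μ) ∧
      (∀ x y : A, δ (x + y) = δ x + δ y) ∧
      (∀ x y : A, δ (x * y) = δ x * y + x * δ y) ∧
      ∀ t : A, Δ t = μ * t + δ t := by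
  obtain ⟨k, rfl⟩ : ∃ k, n = k + 2 := ⟨n - 2, by lia⟩
  have hl : ∀ x, e₁ * (e₁ * x) = e₁ * x := fun x => by rw [← mul_assoc, hidem]
  have hr : ∀ x, (1 - e₁) * ((1 - e₁) * x) = (1 - e₁) * x := fun x => by
    rw [← mul_assoc]; congr 1; simp [mul_sub, sub_mul, hidem]
  have h : IsTriangularPair e₁ (1 - e₁) :=
    { add_eq_one := add_sub_cancel e₁ 1
      idem := hidem
      tri := fun a => by rw [← mul_assoc, htri]
      faithL := fun t ht => by
        rw [← mul_assoc]
        exact hfaithL t fun a => by simpa only [mul_assoc, hl] using ht a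
      faithR := fun t ht => by
        rw [← mul_assoc]
        exact hfaithR t fun a => by simpa only [mul_assoc, hr] using ht a
      two_torsion := fun t ht => h2 t (by rw [two_mul, ht]) }
  obtain ⟨c, δ, hc, hadd, hmul, hδ⟩ := hδ₀.isJordanDerivOn.exists_derivation_add_central h
  obtain ⟨hF, hF'⟩ := eq_central_mul_of_map_jordIter h (F := fun t => Δ t - δ₀ t)
    (hΔ.sub_iterate hδ₀)
  refine ⟨Δ 1 - δ₀ 1 + c, δ, fun a => ?_, hadd, hmul, fun t => ?_⟩
  · rw [add_mul, mul_add, hc, hF]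
  · rw [add_mul, add_assoc, ← hδ, ← hF', sub_add_cancel]
end
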